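/- arXiv:2307.13371 — 4 statements merged into one kernel-verified Lean document; each statement's English description precedes it below -/
import Mathlib

section
/- Let (Ω, P) be a probability space, D a finite nonempty set, and F : D → Ω → ℝ a family of real-valued random variables. For each integer t ≥ 1 and each j ∈ {1,2}, let μ_{j,t}, σ_{j,t} : D × Ω → ℝ be measurable with σ_{j,t}(x, ω) > 0, and assume that for every (t, j, x) the standardized residual ω ↦ (F x ω − μ_{j,t}(x, ω))/σ_{j,t}(x, ω) has law the standard Gaussian N(0,1). Let δ ∈ (0,1), let (π_t)_{t≥1} be positive reals with Σ_{t≥1} π_t^{−1} = 1, and set β_t = 2·log(2·|D|·π_t/δ). Define for each ω the intersected historical bounds L̂_t(x, ω) = max over i ≤ t and j ∈ {1,2} of (μ_{j,i}(x, ω) − β_i^{1/2}·σ_{j,i}(x, ω)) and Û_t(x, ω) = min over i ≤ t and j ∈ {1,2} of (μ_{j,i}(x, ω) + β_i^{1/2}·σ_{j,i}(x, ω)). Then with probability at least 1 − δ: for every t ≥ 1, max_{x∈D} L̂_t(x, ω) ≤ max_{x∈D} F x ω ≤ max_{x∈D} Û_t(x, ω). -/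
open MeasureTheory ProbabilityTheory

/-- If `x` lies on the side of `0` opposite to `m`, the density of `N(m, 1)` at `x` is at most
`exp (-m² / 2)` times the standard Gaussian density. -/
lemma gaussianPDF_le_exp_mul_gaussianPDF_zero {m x : ℝ} (h : m * x ≤ 0) :
    gaussianPDF m 1 x ≤ ENNReal.ofReal (Real.exp (-m ^ 2 / 2)) * gaussianPDF 0 1 x := by
  rw [gaussianPDF, gaussianPDF, ← ENNReal.ofReal_mul (Real.exp_nonneg _)]
  apply ENNReal.ofReal_le_ofReal
  rw [gaussianPDFReal, gaussianPDFReal, mul_left_comm, ← Real.exp_add]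
  gcongr
  simp only [NNReal.coe_one]
  nlinarith

lemma gaussianReal_le_exp_mul_gaussianReal_zero {m : ℝ} {s : Set ℝ} (hs : MeasurableSet s)
    (h : ∀ x ∈ s, m * x ≤ 0) :
    gaussianReal m 1 s ≤ ENNReal.ofReal (Real.exp (-m ^ 2 / 2)) * gaussianReal 0 1 s := by
  rw [gaussianReal_apply _ one_ne_zero, gaussianReal_apply _ one_ne_zero,
    ← lintegral_const_mul _ (measurable_gaussianPDF 0 1)]
  exact setLIntegral_mono' hs fun x hx => gaussianPDF_le_exp_mul_gaussianPDF_zero (h x hx)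

/-- The two-sided Gaussian tail bound with constant `1`. -/
lemma gaussianReal_lt_abs_le {c : ℝ} (hc : 0 ≤ c) :
    gaussianReal 0 1 {x | c < |x|} ≤ ENNReal.ofReal (Real.exp (-c ^ 2 / 2)) := by
  have shift (m : ℝ) (s : Set ℝ) (hs : MeasurableSet s) :
      gaussianReal m 1 s = gaussianReal 0 1 ((· + m) ⁻¹' s) := by
    rw [← Measure.map_apply (measurable_add_const m) hs, gaussianReal_map_add_const, zero_add]
  have hset : {x : ℝ | c < |x|} = (· + -c) ⁻¹' Set.Ioi 0 ∪ (· + c) ⁻¹' Set.Iio 0 := by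
    ext x
    simp only [Set.mem_ofPred_eq, lt_abs, Set.mem_union, Set.mem_preimage, Set.mem_Ioi,
      Set.mem_Iio]
    constructor <;> rintro (h | h) <;> first | (left; linarith) | (right; linarith)
  have hright := gaussianReal_le_exp_mul_gaussianReal_zero (m := -c) measurableSet_Ioi
    (fun x (hx : 0 < x) => by nlinarith)
  have hleft := gaussianReal_le_exp_mul_gaussianReal_zero (m := c) measurableSet_Iio
    (fun x (hx : x < 0) => by nlinarith)
  rw [neg_sq] at hright
  calc gaussianReal 0 1 {x | c < |x|}
      ≤ gaussianReal (-c) 1 (Set.Ioi 0) + gaussianReal c 1 (Set.Iio 0) := by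
        rw [hset, shift _ _ measurableSet_Ioi, shift _ _ measurableSet_Iio]
        exact measure_union_le _ _
    _ ≤ ENNReal.ofReal (Real.exp (-c ^ 2 / 2)) *
          (gaussianReal 0 1 (Set.Ioi 0) + gaussianReal 0 1 (Set.Iio 0)) := by
        rw [mul_add]
        exact add_le_add hright hleft
    _ ≤ ENNReal.ofReal (Real.exp (-c ^ 2 / 2)) * 1 := by
        gcongr
        have hdisj : Disjoint (Set.Ioi (0 : ℝ)) (Set.Iio 0) :=
          Set.disjoint_left.2 fun _ hpos hneg => lt_asymm (Set.mem_Ioi.1 hpos) (Set.mem_Iio.1 hneg)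
        rw [← measure_union hdisj measurableSet_Iio]
        exact prob_le_one
    _ = _ := mul_one _

/-- If `|f x - m i j x| ≤ w i j x` for all `i ≥ 1`, then the maximum of `f` lies between the maxima
of the intersected lower and upper bounds. -/
lemma iSup_mem_intersected_bounds {D J : Type*} [Finite D] [Finite J] [Nonempty D] [Nonempty J]
    {f : D → ℝ} {m w : ℕ → J → D → ℝ} (h : ∀ i, 1 ≤ i → ∀ j x, |f x - m i j x| ≤ w i j x)
    {t : ℕ} (ht : 1 ≤ t) :
    (⨆ x : D, ⨆ i : Finset.Icc 1 t, ⨆ j : J, (m (i : ℕ) j x - w (i : ℕ) j x)) ≤ ⨆ x : D, f x ∧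
      ⨆ x : D, f x ≤ ⨆ x : D, ⨅ i : Finset.Icc 1 t, ⨅ j : J, (m (i : ℕ) j x + w (i : ℕ) j x) := by
  have : Nonempty (Finset.Icc 1 t) := ⟨⟨1, Finset.mem_Icc.2 ⟨le_rfl, ht⟩⟩⟩
  constructor
  · refine ciSup_mono (Set.finite_range _).bddAbove fun x => ciSup_le fun i => ciSup_le fun j => ?_
    linarith [(abs_le.1 (h i (Finset.mem_Icc.1 i.2).1 j x)).1]
  · refine ciSup_mono (Set.finite_range _).bddAbove fun x => le_ciInf fun i => le_ciInf fun j => ?_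
    linarith [(abs_le.1 (h i (Finset.mem_Icc.1 i.2).1 j x)).2]

/-- Lemma 1 of the paper: with intersected historical confidence bounds
`L̂_t(x) = max_{i ≤ t, j} (μ_{j,i}(x) − √β_i σ_{j,i}(x))` and
`Û_t(x) = min_{i ≤ t, j} (μ_{j,i}(x) + √β_i σ_{j,i}(x))`, with probability at least
`1 − δ`, for all `t ≥ 1` the maximum `max_x F x` lies in
`[max_x L̂_t(x), max_x Û_t(x)]`. -/
theorem lemma1_max_in_intersected_CI
    {Ω : Type*} [MeasurableSpace Ω] (P : Measure Ω) [IsProbabilityMeasure P]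
    {D : Type*} [Fintype D] [Nonempty D]
    (F : D → Ω → ℝ) (hF : ∀ x, Measurable (F x))
    (μ σ : ℕ → Fin 2 → D → Ω → ℝ)
    (hμ : ∀ t j x, Measurable (fun ω => μ t j x ω))
    (hσmeas : ∀ t j x, Measurable (fun ω => σ t j x ω))
    (hσpos : ∀ t j x ω, 0 < σ t j x ω)
    (hlaw : ∀ t, 1 ≤ t → ∀ j x,
      P.map (fun ω => (F x ω - μ t j x ω) / σ t j x ω) = gaussianReal 0 1)
    (δ : ℝ) (hδ0 : 0 < δ) (hδ1 : δ < 1)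
    (π : ℕ → ℝ) (hπ : ∀ t, 1 ≤ t → 0 < π t)
    (hπsum : ∑' t : ℕ, (π (t + 1))⁻¹ = 1)
    (β : ℕ → ℝ)
    (hβ : ∀ t, β t = 2 * Real.log (2 * (Fintype.card D : ℝ) * π t / δ)) :
    1 - ENNReal.ofReal δ ≤
      P {ω | ∀ t, 1 ≤ t →
        (⨆ x : D, ⨆ i : Finset.Icc 1 t, ⨆ j : Fin 2,
            (μ (i : ℕ) j x ω - Real.sqrt (β (i : ℕ)) * σ (i : ℕ) j x ω))
          ≤ (⨆ x : D, F x ω) ∧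
        (⨆ x : D, F x ω) ≤
          ⨆ x : D, ⨅ i : Finset.Icc 1 t, ⨅ j : Fin 2,
            (μ (i : ℕ) j x ω + Real.sqrt (β (i : ℕ)) * σ (i : ℕ) j x ω)} := by
  have hsum : Summable fun t : ℕ => (π (t + 1))⁻¹ := by
    by_contra h
    simp [tsum_eq_zero_of_not_summable h] at hπsum
  have hinv_nonneg (t : ℕ) : 0 ≤ (π (t + 1))⁻¹ := (inv_pos.2 (hπ _ t.succ_pos)).le
  have hπ_one (t : ℕ) : 1 ≤ π (t + 1) := by
    have := hsum.le_tsum t fun s _ => hinv_nonneg s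
    rw [hπsum] at this
    exact (inv_le_one₀ (hπ _ t.succ_pos)).1 this
  have hcard : (1 : ℝ) ≤ Fintype.card D := by exact_mod_cast Fintype.card_pos
  have hβ_nonneg (t : ℕ) : 0 ≤ β (t + 1) := by
    rw [hβ]
    refine mul_nonneg zero_le_two (Real.log_nonneg ?_)
    rw [le_div_iff₀ hδ0]
    nlinarith [hπ_one t, mul_le_mul hcard (hπ_one t) zero_le_one (by linarith)]
  have hexp (t : ℕ) : Real.exp (-Real.sqrt (β (t + 1)) ^ 2 / 2) =
      δ / (2 * Fintype.card D * π (t + 1)) := by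
    have hpos := hπ _ t.succ_pos
    rw [Real.sq_sqrt (hβ_nonneg t), hβ, neg_div, mul_div_cancel_left₀ _ two_ne_zero, Real.exp_neg,
      Real.exp_log (by positivity), inv_div]
  let Z : ℕ → Fin 2 × D → Ω → ℝ := fun t p ω => (F p.2 ω - μ t p.1 p.2 ω) / σ t p.1 p.2 ω
  let bad : Set Ω := ⋃ t : ℕ, ⋃ p : Fin 2 × D,
    {ω | Real.sqrt (β (t + 1)) < |Z (t + 1) p ω|}
  have htail (t : ℕ) (p : Fin 2 × D) : P {ω | Real.sqrt (β (t + 1)) < |Z (t + 1) p ω|} ≤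
      ENNReal.ofReal (δ / (2 * Fintype.card D * π (t + 1))) := by
    have hZ : Measurable (Z (t + 1) p) := ((hF p.2).sub (hμ _ _ _)).div (hσmeas _ _ _)
    rw [← hexp t]
    refine le_trans (le_of_eq ?_) (gaussianReal_lt_abs_le (Real.sqrt_nonneg _))
    rw [← hlaw (t + 1) t.succ_pos p.1 p.2,
      Measure.map_apply hZ (measurableSet_lt measurable_const measurable_abs)]
    rfl
  have hbad : P bad ≤ ENNReal.ofReal δ := by
    calc P bad ≤ ∑' t : ℕ, P (⋃ p : Fin 2 × D, {ω | Real.sqrt (β (t + 1)) < |Z (t + 1) p ω|}) :=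
          measure_iUnion_le _
      _ ≤ ∑' t : ℕ, ENNReal.ofReal (δ * (π (t + 1))⁻¹) := by
          refine ENNReal.tsum_le_tsum fun t => ?_
          refine (measure_iUnion_fintype_le P _).trans ?_
          refine (Finset.sum_le_sum fun p _ => htail t p).trans (le_of_eq ?_)
          have hpos := hπ _ t.succ_pos
          rw [← ENNReal.ofReal_sum_of_nonneg fun _ _ => by positivity]
          congr 1
          simp only [Finset.sum_const, Finset.card_univ, Fintype.card_prod, Fintype.card_fin,
            nsmul_eq_mul, Nat.cast_mul, Nat.cast_ofNat]
          field_simp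
      _ = ENNReal.ofReal δ := by
          rw [← ENNReal.ofReal_tsum_of_nonneg (fun t => mul_nonneg hδ0.le (hinv_nonneg t))
            (hsum.mul_left δ), tsum_mul_left, hπsum, mul_one]
  rw [tsub_le_iff_right]
  refine le_trans ?_ (add_le_add_right hbad _)
  rw [← measure_univ (μ := P)]
  refine (measure_mono fun ω _ => ?_).trans (measure_union_le _ _)
  by_cases hω : ω ∈ bad
  · exact Or.inr hω
  refine Or.inl fun t ht => iSup_mem_intersected_bounds (f := fun x => F x ω)
    (m := fun i j x => μ i j x ω) (w := fun i j x => Real.sqrt (β i) * σ i j x ω) ?_ ht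
  intro i hi j x
  obtain ⟨s, rfl⟩ := Nat.exists_eq_add_of_le' hi
  simp only [bad, Set.mem_iUnion, Set.mem_ofPred_eq, not_exists, not_lt] at hω
  have := hω s (j, x)
  rwa [abs_div, abs_of_pos (hσpos _ _ _ _), div_le_iff₀ (hσpos _ _ _ _)] at this
end

section
/- Let (Ω, P) be a probability space, D a finite nonempty set, and F : D → Ω → ℝ a family of real-valued random variables. For each integer t ≥ 1, let μ_t, σ_t : D × Ω → ℝ be measurable with σ_t(x, ω) > 0, and assume that for every (t, x) the standardized residual ω ↦ (F x ω − μ_t(x, ω))/σ_t(x, ω) has law the standard Gaussian N(0,1). Let δ ∈ (0,1), let (π_t)_{t≥1} be positive reals with Σ_{t≥1} π_t^{−1} = 1, and set β_t = 2·log(2·|D|·π_t/δ). Then with probability at least 1 − δ: for every t ≥ 1 and every x* ∈ D maximizing x ↦ F x ω over D, one has μ_t(x*, ω) + β_t^{1/2}·σ_t(x*, ω) ≥ max_{x∈D} (μ_t(x, ω) − β_t^{1/2}·σ_t(x, ω)); that is, x* belongs to the region of interest ROI_t(ω) = {x ∈ D : μ_t(x, ω) + β_t^{1/2}σ_t(x,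 ω) ≥ max_{x'∈D} (μ_t(x', ω) − β_t^{1/2}σ_t(x', ω))}. -/
open MeasureTheory ProbabilityTheory

/-- A standard Gaussian random variable is sub-Gaussian with parameter `1`. -/
theorem hasSubgaussianMGF_of_map_eq_gaussianReal
    {Ω : Type*} [MeasurableSpace Ω] {P : Measure Ω} {Z : Ω → ℝ} (hZ : Measurable Z)
    (hlaw : P.map Z = gaussianReal 0 1) : HasSubgaussianMGF Z 1 P where
  integrable_exp_mul t := by
    have h : Integrable (fun x : ℝ => Real.exp (t * x)) (P.map Z) :=
      hlaw ▸ integrable_exp_mul_gaussianReal t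
    exact h.comp_measurable hZ
  mgf_le t := by
    rw [mgf_gaussianReal hlaw]
    simp

/-- Two-sided Chernoff bound for a standard Gaussian random variable. -/
theorem measure_sqrt_lt_abs_le_of_map_eq_gaussianReal
    {Ω : Type*} [MeasurableSpace Ω] {P : Measure Ω} [IsProbabilityMeasure P] {Z : Ω → ℝ}
    (hZ : Measurable Z) (hlaw : P.map Z = gaussianReal 0 1) {b : ℝ} (hb : 0 ≤ b) :
    P {ω | Real.sqrt b < |Z ω|} ≤ ENNReal.ofReal (2 * Real.exp (-(b / 2))) := by
  have hsub := hasSubgaussianMGF_of_map_eq_gaussianReal hZ hlaw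
  have hpos := hsub.measure_ge_le (Real.sqrt_nonneg b)
  have hneg := hsub.neg.measure_ge_le (Real.sqrt_nonneg b)
  have hexp : -Real.sqrt b ^ 2 / (2 * ((1 : NNReal) : ℝ)) = -(b / 2) := by
    rw [Real.sq_sqrt hb, NNReal.coe_one]
    ring
  rw [hexp] at hpos hneg
  have hsubset : {ω | Real.sqrt b < |Z ω|} ⊆
      {ω | Real.sqrt b ≤ Z ω} ∪ {ω | Real.sqrt b ≤ (-Z) ω} := by
    intro ω (hω : Real.sqrt b < |Z ω|)
    rcases lt_abs.mp hω with h | h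
    · exact Or.inl h.le
    · exact Or.inr h.le
  rw [← ofReal_measureReal]
  apply ENNReal.ofReal_le_ofReal
  calc P.real {ω | Real.sqrt b < |Z ω|}
      ≤ P.real ({ω | Real.sqrt b ≤ Z ω} ∪ {ω | Real.sqrt b ≤ (-Z) ω}) :=
        measureReal_mono hsubset
    _ ≤ _ := measureReal_union_le _ _
    _ ≤ 2 * Real.exp (-(b / 2)) := by linarith

/-- Corollary 1 of the paper: under the Gaussian standardized-residual assumption on the
global posterior `(μ_t, σ_t)`, with probability at least `1 − δ`, for every `t ≥ 1`, any
maximizer `x*` of the unknown function lies in the region of interest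
`ROI_t = {x : UCB_t(x) ≥ max_{x'} LCB_t(x')}`. -/
theorem corollary1_maximizer_in_ROI
    {Ω : Type*} [MeasurableSpace Ω] (P : Measure Ω) [IsProbabilityMeasure P]
    {D : Type*} [Fintype D] [Nonempty D]
    (F : D → Ω → ℝ) (hF : ∀ x, Measurable (F x))
    (μ σ : ℕ → D → Ω → ℝ)
    (hμ : ∀ t x, Measurable (fun ω => μ t x ω))
    (hσmeas : ∀ t x, Measurable (fun ω => σ t x ω))
    (hσpos : ∀ t x ω, 0 < σ t x ω)
    (hlaw : ∀ t, 1 ≤ t → ∀ x,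
      P.map (fun ω => (F x ω - μ t x ω) / σ t x ω) = gaussianReal 0 1)
    (δ : ℝ) (hδ0 : 0 < δ) (hδ1 : δ < 1)
    (π : ℕ → ℝ) (hπ : ∀ t, 1 ≤ t → 0 < π t)
    (hπsum : ∑' t : ℕ, (π (t + 1))⁻¹ = 1)
    (β : ℕ → ℝ)
    (hβ : ∀ t, β t = 2 * Real.log (2 * (Fintype.card D : ℝ) * π t / δ)) :
    1 - ENNReal.ofReal δ ≤
      P {ω | ∀ t, 1 ≤ t → ∀ xstar : D, (∀ x, F x ω ≤ F xstar ω) →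
        (⨆ x : D, (μ t x ω - Real.sqrt (β t) * σ t x ω)) ≤
          μ t xstar ω + Real.sqrt (β t) * σ t xstar ω} := by
  have hsum : Summable fun t : ℕ => (π (t + 1))⁻¹ := by
    by_contra h
    rw [tsum_eq_zero_of_not_summable h] at hπsum
    exact zero_ne_one hπsum
  have hinv_nonneg (t : ℕ) : 0 ≤ (π (t + 1))⁻¹ := (inv_pos.mpr (hπ _ (by omega))).le
  have hcard : (1 : ℝ) ≤ Fintype.card D := by
    exact_mod_cast Fintype.card_pos (α := D)
  let bad (t : ℕ) (x : D) : Set Ω :=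
    {ω | Real.sqrt (β (t + 1)) < |(F x ω - μ (t + 1) x ω) / σ (t + 1) x ω|}
  have hbad (t : ℕ) (x : D) :
      P (bad t x) ≤ ENNReal.ofReal (δ / Fintype.card D * (π (t + 1))⁻¹) := by
    have hπpos : 0 < π (t + 1) := hπ _ (by omega)
    have hπone : 1 ≤ π (t + 1) := by
      have h := hsum.le_tsum t fun j _ => hinv_nonneg j
      rw [hπsum] at h
      exact (inv_le_one₀ hπpos).mp h
    have hβ_nonneg : 0 ≤ β (t + 1) := by
      rw [hβ]
      refine mul_nonneg zero_le_two (Real.log_nonneg ?_)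
      rw [le_div_iff₀ hδ0]
      nlinarith [mul_le_mul hcard hπone zero_le_one (zero_le_one.trans hcard)]
    have hmeas : Measurable fun ω => (F x ω - μ (t + 1) x ω) / σ (t + 1) x ω :=
      ((hF x).sub (hμ _ x)).div (hσmeas _ x)
    refine (measure_sqrt_lt_abs_le_of_map_eq_gaussianReal hmeas
      (hlaw _ (by omega) x) hβ_nonneg).trans_eq ?_
    have hcard_pos : (0 : ℝ) < Fintype.card D := zero_lt_one.trans_le hcard
    rw [hβ, mul_div_cancel_left₀ _ (two_ne_zero' ℝ), Real.exp_neg, Real.exp_log (by positivity)]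
    congr 1
    field_simp
  have hunion : P (⋃ t, ⋃ x, bad t x) ≤ ENNReal.ofReal δ := by
    calc P (⋃ t, ⋃ x, bad t x)
        ≤ ∑' t, P (⋃ x, bad t x) := measure_iUnion_le _
      _ ≤ ∑' t, ENNReal.ofReal (δ * (π (t + 1))⁻¹) := by
        refine ENNReal.tsum_le_tsum fun t => ?_
        calc P (⋃ x, bad t x)
            ≤ ∑ x, P (bad t x) := measure_iUnion_fintype_le _ _
          _ ≤ ∑ _x : D, ENNReal.ofReal (δ / Fintype.card D * (π (t + 1))⁻¹) :=
            Finset.sum_le_sum fun x _ => hbad t x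
          _ = ENNReal.ofReal (δ * (π (t + 1))⁻¹) := by
            rw [Finset.sum_const, Finset.card_univ, ← ENNReal.ofReal_nsmul, nsmul_eq_mul]
            congr 1
            field_simp
      _ = ENNReal.ofReal δ := by
        rw [← ENNReal.ofReal_tsum_of_nonneg (fun t => mul_nonneg hδ0.le (hinv_nonneg t))
          (hsum.mul_left δ), tsum_mul_left, hπsum, mul_one]
  have hgood : (⋃ t, ⋃ x, bad t x)ᶜ ⊆
      {ω | ∀ t, 1 ≤ t → ∀ xstar : D, (∀ x, F x ω ≤ F xstar ω) →
        (⨆ x : D, (μ t x ω - Real.sqrt (β t) * σ t x ω)) ≤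
          μ t xstar ω + Real.sqrt (β t) * σ t xstar ω} := by
    intro ω hω t ht xstar hmax
    obtain ⟨s, rfl⟩ := Nat.exists_eq_add_of_le' ht
    have hconf (x : D) :
        |F x ω - μ (s + 1) x ω| ≤ Real.sqrt (β (s + 1)) * σ (s + 1) x ω := by
      have hx : |(F x ω - μ (s + 1) x ω) / σ (s + 1) x ω| ≤ Real.sqrt (β (s + 1)) :=
        not_lt.mp fun h => hω (Set.mem_iUnion₂.mpr ⟨s, x, h⟩)
      rwa [abs_div, abs_of_pos (hσpos _ x ω), div_le_iff₀ (hσpos _ x ω)] at hx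
    refine ciSup_le fun x => ?_
    linarith [hmax x, (abs_le.mp (hconf x)).1, (abs_le.mp (hconf xstar)).2]
  calc 1 - ENNReal.ofReal δ
      ≤ 1 - P (⋃ t, ⋃ x, bad t x) := tsub_le_tsub_left hunion 1
    _ ≤ P (⋃ t, ⋃ x, bad t x)ᶜ := by
      rw [tsub_le_iff_left, ← measure_univ (μ := P), ← Set.union_compl_self (⋃ t, ⋃ x, bad t x)]
      exact measure_union_le _ _
    _ ≤ _ := measure_mono hgood
end

section
/- Let (Ω, P) be a probability space, D a finite nonempty set, and F : D → Ω → ℝ a family of real-valued random variables. For each integer t ≥ 1 and each j ∈ {1,2}, let μ_{j,t}, σ_{j,t} : D × Ω → ℝ be measurable with σ_{j,t}(x, ω) > 0, and assume that for every (t, j, x) the standardized residual ω ↦ (F x ω − μ_{j,t}(x, ω))/σ_{j,t}(x, ω) has law the standard Gaussian N(0,1). Let δ ∈ (0,1), let (π_t)_{t≥1} be positive reals with Σ_{t≥1} π_t^{−1} = 1, and set β_t = 2·log(2·|D|·π_t/δ). For each ω and t define the region of interest R_t(ω) = {x ∈ D : μ_{1,t}(x, ω) + β_t^{1/2}σ_{1,t}(x,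 ω) ≥ max_{x'∈D} (μ_{1,t}(x', ω) − β_t^{1/2}σ_{1,t}(x', ω))} (which is nonempty since any maximizer of the lower confidence bound belongs to it), and define L̂_t(x, ω) = max over i ≤ t and j of (μ_{j,i}(x, ω) − β_i^{1/2}σ_{j,i}(x, ω)), Û_t(x, ω) = min over i ≤ t and j of (μ_{j,i}(x, ω) + β_i^{1/2}σ_{j,i}(x, ω)), L̃_t(x, ω) = max over j of (μ_{j,t}(x, ω) − β_t^{1/2}σ_{j,t}(x, ω)), Ũ_t(x, ω) = min over j of (μ_{j,t}(x, ω) + β_t^{1/2}σ_{j,t}(x, ω)). Then with probability at least 1 − 2δ: for every t ≥ 1, max_{x∈R_t(ω)} L̂_t(x, ω) ≤ max_{x∈D} F x ω ≤ max_{x∈R_t(ω)} Û_t(x, ω), and moreover max_{x∈R_t(ω)} L̃_t(x, ω) ≤ max_{x∈R_t(ω)} L̂_t(x, ω) and max_{x∈R_t(ω)} Û_t(x, ω) ≤ max_{x∈R_t(ω)} Ũ_t(x, ω). -/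
open MeasureTheory ProbabilityTheory

/-- Two-sided Chernoff bound for the standard Gaussian. -/
lemma gaussianReal_abs_ge_le {c : ℝ} (hc : 0 ≤ c) :
    gaussianReal 0 1 {z : ℝ | c ≤ |z|} ≤ ENNReal.ofReal (2 * Real.exp (-c ^ 2 / 2)) := by
  have hsub : HasSubgaussianMGF (id : ℝ → ℝ) 1 (gaussianReal 0 1) :=
    { integrable_exp_mul := fun t => integrable_exp_mul_gaussianReal t
      mgf_le := fun t => by rw [mgf_id_gaussianReal]; simp }
  have hpos : (gaussianReal 0 1).real {z : ℝ | c ≤ z} ≤ Real.exp (-c ^ 2 / 2) := by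
    simpa using hsub.measure_ge_le hc
  have hneg : (gaussianReal 0 1).real {z : ℝ | c ≤ -z} ≤ Real.exp (-c ^ 2 / 2) := by
    simpa using hsub.neg.measure_ge_le hc
  have hunion : {z : ℝ | c ≤ |z|} = {z : ℝ | c ≤ z} ∪ {z : ℝ | c ≤ -z} := by
    ext z
    simp [le_abs]
  refine (ENNReal.le_ofReal_iff_toReal_le (measure_ne_top _ _) (by positivity)).2 ?_
  change (gaussianReal 0 1).real _ ≤ _
  rw [hunion]
  linarith [measureReal_union_le (μ := gaussianReal 0 1) {z : ℝ | c ≤ z} {z : ℝ | c ≤ -z}]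

/-- If every interval `[l t j x, u t j x]` contains `f x`, then on the region of interest the
maximum of `f` lies between the maxima of the historical intersected bounds, which are at least as
tight as the intersected bounds of the current step. -/
lemma iSup_mem_nested_bounds {D ι : Type*} [Finite D] [Nonempty D] [Finite ι] [Nonempty ι]
    (f : D → ℝ) (l u : ℕ → ι → D → ℝ) (hl : ∀ t, 1 ≤ t → ∀ j x, l t j x ≤ f x)
    (hu : ∀ t, 1 ≤ t → ∀ j x, f x ≤ u t j x) {t : ℕ} (ht : 1 ≤ t) (j₀ : ι) (R : Set D)
    (hR : R = {x | (⨆ x', l t j₀ x') ≤ u t j₀ x}) :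
    ((⨆ x : R, ⨆ i : Finset.Icc 1 t, ⨆ j, l i j x) ≤ (⨆ x, f x) ∧
      (⨆ x, f x) ≤ ⨆ x : R, ⨅ i : Finset.Icc 1 t, ⨅ j, u i j x) ∧
    ((⨆ x : R, ⨆ j, l t j x) ≤ (⨆ x : R, ⨆ i : Finset.Icc 1 t, ⨆ j, l i j x) ∧
      (⨆ x : R, ⨅ i : Finset.Icc 1 t, ⨅ j, u i j x) ≤ ⨆ x : R, ⨅ j, u t j x) := by
  have hone (i : Finset.Icc 1 t) : 1 ≤ (i : ℕ) := (Finset.mem_Icc.1 i.2).1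
  let last : Finset.Icc 1 t := ⟨t, Finset.mem_Icc.2 ⟨ht, le_rfl⟩⟩
  have : Nonempty (Finset.Icc 1 t) := ⟨last⟩
  have hfle (x : D) : f x ≤ ⨆ x, f x := le_ciSup (Set.finite_range f).bddAbove x
  obtain ⟨y, hy⟩ := exists_eq_ciSup_of_finite (f := f)
  have hyR : y ∈ R := by
    rw [hR]
    exact ciSup_le fun x' => (hl t ht j₀ x').trans <|
      ((hfle x').trans hy.ge).trans (hu t ht j₀ y)
  have : Nonempty R := ⟨⟨y, hyR⟩⟩
  refine ⟨⟨?_, ?_⟩, ?_, ?_⟩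
  · exact ciSup_le fun x => ciSup_le fun i => ciSup_le fun j =>
      (hl i (hone i) j x).trans (hfle x)
  · rw [← hy]
    exact le_ciSup_of_le (Set.finite_range _).bddAbove (⟨y, hyR⟩ : R) <|
      le_ciInf fun i => le_ciInf fun j => hu i (hone i) j y
  · exact ciSup_mono (Set.finite_range _).bddAbove fun x =>
      le_ciSup (f := fun i : Finset.Icc 1 t => ⨆ j, l i j x) (Set.finite_range _).bddAbove last
  · exact ciSup_mono (Set.finite_range _).bddAbove fun x =>
      ciInf_le (f := fun i : Finset.Icc 1 t => ⨅ j, u i j x) (Set.finite_range _).bddBelow last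

/-- Corollary 2 of the paper: with probability at least `1 − 2δ`, for every `t ≥ 1` the
optimum `max_x F x` lies in the confidence interval `ĈI_{t,max}(D ∩ ROI_t)` built from
all historical intersected bounds, which is itself contained in `C̃I_{t,max}(D ∩ ROI_t)`
built from the step-`t` intersected bounds. Model index `0` is the global model and `1`
the ROI model. -/
theorem corollary2_optimum_in_nested_CIs
    {Ω : Type*} [MeasurableSpace Ω] (P : Measure Ω) [IsProbabilityMeasure P]
    {D : Type*} [Fintype D] [Nonempty D]
    (F : D → Ω → ℝ) (hF : ∀ x, Measurable (F x))
    (μ σ : ℕ → Fin 2 → D → Ω → ℝ)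
    (hμ : ∀ t j x, Measurable (fun ω => μ t j x ω))
    (hσmeas : ∀ t j x, Measurable (fun ω => σ t j x ω))
    (hσpos : ∀ t j x ω, 0 < σ t j x ω)
    (hlaw : ∀ t, 1 ≤ t → ∀ j x,
      P.map (fun ω => (F x ω - μ t j x ω) / σ t j x ω) = gaussianReal 0 1)
    (δ : ℝ) (hδ0 : 0 < δ) (hδ1 : δ < 1)
    (π : ℕ → ℝ) (hπ : ∀ t, 1 ≤ t → 0 < π t)
    (hπsum : ∑' t : ℕ, (π (t + 1))⁻¹ = 1)
    (β : ℕ → ℝ)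
    (hβ : ∀ t, β t = 2 * Real.log (2 * (Fintype.card D : ℝ) * π t / δ))
    -- region of interest at time `t` and outcome `ω`, from the global model (index 0)
    (R : ℕ → Ω → Set D)
    (hR : ∀ t ω, R t ω = {x : D |
      (⨆ x' : D, (μ t 0 x' ω - Real.sqrt (β t) * σ t 0 x' ω)) ≤
        μ t 0 x ω + Real.sqrt (β t) * σ t 0 x ω}) :
    1 - 2 * ENNReal.ofReal δ ≤
      P {ω | ∀ t, 1 ≤ t →
        ((⨆ x : R t ω, ⨆ i : Finset.Icc 1 t, ⨆ j : Fin 2,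
              (μ (i : ℕ) j (x : D) ω - Real.sqrt (β (i : ℕ)) * σ (i : ℕ) j (x : D) ω))
            ≤ (⨆ x : D, F x ω) ∧
          (⨆ x : D, F x ω) ≤
            ⨆ x : R t ω, ⨅ i : Finset.Icc 1 t, ⨅ j : Fin 2,
              (μ (i : ℕ) j (x : D) ω + Real.sqrt (β (i : ℕ)) * σ (i : ℕ) j (x : D) ω)) ∧
        ((⨆ x : R t ω, ⨆ j : Fin 2,
              (μ t j (x : D) ω - Real.sqrt (β t) * σ t j (x : D) ω)) ≤
            (⨆ x : R t ω, ⨆ i : Finset.Icc 1 t, ⨆ j : Fin 2,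
              (μ (i : ℕ) j (x : D) ω - Real.sqrt (β (i : ℕ)) * σ (i : ℕ) j (x : D) ω)) ∧
          (⨆ x : R t ω, ⨅ i : Finset.Icc 1 t, ⨅ j : Fin 2,
              (μ (i : ℕ) j (x : D) ω + Real.sqrt (β (i : ℕ)) * σ (i : ℕ) j (x : D) ω)) ≤
            ⨆ x : R t ω, ⨅ j : Fin 2,
              (μ t j (x : D) ω + Real.sqrt (β t) * σ t j (x : D) ω))} := by
  have hsummable : Summable fun t : ℕ => (π (t + 1))⁻¹ := by
    by_contra h
    rw [tsum_eq_zero_of_not_summable h] at hπsum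
    exact zero_ne_one hπsum
  have hinv (t : ℕ) : 0 ≤ (π (t + 1))⁻¹ := (inv_pos.2 (hπ _ t.succ_pos)).le
  have hπone (t : ℕ) : 1 ≤ π (t + 1) := by
    have h := hsummable.le_tsum t fun s _ => hinv s
    rw [hπsum] at h
    exact (inv_le_one₀ (hπ _ t.succ_pos)).1 h
  have hcard : (1 : ℝ) ≤ Fintype.card D := by exact_mod_cast Fintype.card_pos (α := D)
  have hβnonneg (t : ℕ) : 0 ≤ β (t + 1) := by
    rw [hβ]
    refine mul_nonneg zero_le_two (Real.log_nonneg ?_)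
    rw [one_le_div hδ0]
    nlinarith [hπone t]
  have hexp (t : ℕ) : 2 * Real.exp (-√(β (t + 1)) ^ 2 / 2)
      = δ * (π (t + 1))⁻¹ / Fintype.card D := by
    have hp := hπ (t + 1) t.succ_pos
    have hlog : -β (t + 1) / 2 = -Real.log (2 * (Fintype.card D : ℝ) * π (t + 1) / δ) := by
      rw [hβ]
      ring
    rw [Real.sq_sqrt (hβnonneg t), hlog, Real.exp_neg, Real.exp_log (by positivity)]
    field_simp
  let B (t : ℕ) (j : Fin 2) (x : D) : Set Ω :=
    {ω | √(β (t + 1)) ≤ |(F x ω - μ (t + 1) j x ω) / σ (t + 1) j x ω|}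
  have hB (t : ℕ) (j : Fin 2) (x : D) :
      P (B t j x) ≤ ENNReal.ofReal (δ * (π (t + 1))⁻¹ / Fintype.card D) := by
    have hZ : Measurable fun ω => (F x ω - μ (t + 1) j x ω) / σ (t + 1) j x ω :=
      ((hF x).sub (hμ _ j x)).div (hσmeas _ j x)
    have hms : MeasurableSet {z : ℝ | √(β (t + 1)) ≤ |z|} :=
      measurableSet_le measurable_const measurable_id.abs
    have h := gaussianReal_abs_ge_le (Real.sqrt_nonneg (β (t + 1)))
    rwa [← hlaw (t + 1) t.succ_pos j x, Measure.map_apply hZ hms, hexp] at h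
  have hbad : P (⋃ t, ⋃ j, ⋃ x, B t j x) ≤ 2 * ENNReal.ofReal δ := by
    calc P (⋃ t, ⋃ j, ⋃ x, B t j x)
        ≤ ∑' t, ∑ j, ∑ x, P (B t j x) :=
          (measure_iUnion_le _).trans <| ENNReal.tsum_le_tsum fun t =>
            (measure_iUnion_fintype_le P _).trans <| Finset.sum_le_sum fun j _ =>
              measure_iUnion_fintype_le P _
      _ ≤ ∑' t : ℕ, ENNReal.ofReal (2 * δ * (π (t + 1))⁻¹) := by
          refine ENNReal.tsum_le_tsum fun t => (Finset.sum_le_sum fun j _ =>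
            Finset.sum_le_sum fun x _ => hB t j x).trans_eq ?_
          simp only [Finset.sum_const, Finset.card_univ, Fintype.card_fin, ← ENNReal.ofReal_nsmul]
          congr 1
          simp only [nsmul_eq_mul]
          push_cast
          field_simp
      _ = 2 * ENNReal.ofReal δ := by
          rw [← ENNReal.ofReal_tsum_of_nonneg (fun t => mul_nonneg (by positivity) (hinv t))
            (hsummable.mul_left _), tsum_mul_left, hπsum, mul_one,
            ENNReal.ofReal_mul zero_le_two, ENNReal.ofReal_ofNat]
  refine tsub_le_iff_right.2 ?_
  refine le_trans ?_ (add_le_add_right hbad _)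
  rw [← measure_univ (μ := P)]
  refine (measure_mono fun ω _ => ?_).trans (measure_union_le _ _)
  by_cases hω : ω ∈ ⋃ t, ⋃ j, ⋃ x, B t j x
  · exact Or.inr hω
  left
  have habs (t : ℕ) (ht : 1 ≤ t) (j : Fin 2) (x : D) :
      |F x ω - μ t j x ω| ≤ √(β t) * σ t j x ω := by
    obtain ⟨s, rfl⟩ := Nat.exists_eq_add_of_le' ht
    simp only [Set.mem_iUnion, not_exists] at hω
    have h : |(F x ω - μ (s + 1) j x ω) / σ (s + 1) j x ω| < √(β (s + 1)) :=
      not_le.1 (hω s j x)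
    rw [abs_div, abs_of_pos (hσpos _ j x ω), div_lt_iff₀ (hσpos _ j x ω)] at h
    exact h.le
  intro t ht
  exact iSup_mem_nested_bounds (fun x => F x ω)
    (fun t j x => μ t j x ω - √(β t) * σ t j x ω) (fun t j x => μ t j x ω + √(β t) * σ t j x ω)
    (fun t ht j x => by linarith [(abs_le.1 (habs t ht j x)).1])
    (fun t ht j x => by linarith [(abs_le.1 (habs t ht j x)).2]) ht 0 (R t ω) (hR t ω)
end

section
/- Let S be a finite nonempty set, J a finite nonempty index set, β ≥ 0, and for each j ∈ J let μ_j, σ_j : S → ℝ with σ_j x ≥ 0 for all x. Define L̂(x) = max_{j∈J} (μ_j x − β^{1/2}·σ_j x) and Û(x) = min_{j∈J} (μ_j x + β^{1/2}·σ_j x), and let x'' ∈ S be any maximizer over S of x ↦ Û(x) − L̂(x). Then for every j ∈ J: max_{x∈S} Û(x) − max_{x∈S} L̂(x) ≤ Û(x'') − L̂(x'') ≤ 2·β^{1/2}·σ_j(x''). -/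
/-- Lemma 2 (appendix, `lem:acqCIBound`): with intersected bounds
`L̂(x) = max_j (μ_j x − √β σ_j x)` and `Û(x) = min_j (μ_j x + √β σ_j x)`, if `x''`
maximizes the width `Û − L̂` over `S`, then for every model `j`,
`max_S Û − max_S L̂ ≤ Û(x'') − L̂(x'') ≤ 2 √β σ_j(x'')`. -/
theorem acquisition_CI_width_bound
    {S : Type*} [Fintype S] [Nonempty S]
    {J : Type*} [Fintype J] [Nonempty J]
    (β : ℝ) (hβ : 0 ≤ β)
    (μ σ : J → S → ℝ) (hσ : ∀ j x, 0 ≤ σ j x)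
    (xpp : S)
    (hxpp : ∀ x : S,
      (⨅ j : J, (μ j x + Real.sqrt β * σ j x)) - (⨆ j : J, (μ j x - Real.sqrt β * σ j x))
        ≤ (⨅ j : J, (μ j xpp + Real.sqrt β * σ j xpp)) -
            (⨆ j : J, (μ j xpp - Real.sqrt β * σ j xpp))) :
    ∀ j : J,
      (⨆ x : S, ⨅ j' : J, (μ j' x + Real.sqrt β * σ j' x)) -
          (⨆ x : S, ⨆ j' : J, (μ j' x - Real.sqrt β * σ j' x)) ≤
        (⨅ j' : J, (μ j' xpp + Real.sqrt β * σ j' xpp)) -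
          (⨆ j' : J, (μ j' xpp - Real.sqrt β * σ j' xpp)) ∧
      (⨅ j' : J, (μ j' xpp + Real.sqrt β * σ j' xpp)) -
          (⨆ j' : J, (μ j' xpp - Real.sqrt β * σ j' xpp)) ≤
        2 * Real.sqrt β * σ j xpp := by
  intro j
  constructor
  · rw [sub_le_iff_le_add]
    refine ciSup_le fun x => ?_
    have hx := hxpp x
    have hle : (⨆ j' : J, (μ j' x - Real.sqrt β * σ j' x)) ≤
        ⨆ x : S, ⨆ j' : J, (μ j' x - Real.sqrt β * σ j' x) :=
      le_ciSup (f := fun x : S => ⨆ j' : J, (μ j' x - Real.sqrt β * σ j' x))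
        (Set.finite_range _).bddAbove x
    linarith
  · have hU : (⨅ j' : J, (μ j' xpp + Real.sqrt β * σ j' xpp)) ≤
        μ j xpp + Real.sqrt β * σ j xpp :=
      ciInf_le (Set.finite_range _).bddBelow j
    have hL : μ j xpp - Real.sqrt β * σ j xpp ≤
        ⨆ j' : J, (μ j' xpp - Real.sqrt β * σ j' xpp) :=
      le_ciSup (f := fun j' : J => μ j' xpp - Real.sqrt β * σ j' xpp)
        (Set.finite_range _).bddAbove j
    linarith
end
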